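/- Let q = 2m with m ≥ 2 an integer, and let the design space Ω be the set of all nonzero vectors in {0,1}^q. Let p_ev2 be the design measure assigning mass n_m⁻¹, where n_m = C(q,m), to each design point with exactly m ones and mass 0 to every other design point. Let t_2(q) = 1 − (1/2)(q−1)⁻²[q + {4(q−1)² + q²}^{1/2}]. Then for t ∈ [0,1), p_ev2 is A-optimal (H(p_ev2) is invertible and tr{H(p_ev2)}⁻¹ ≤ tr{H(p)}⁻¹ for every design measure p on Ω with H(p) invertible) if and only if 0 ≤ t ≤ t_2(q). -/

import Mathlib

open Matrix BigOperators Finset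

noncomputable section

/-- The binary design point (0/1 vector) with support `S`. -/
def ind {q : ℕ} (S : Finset (Fin q)) : Fin q → ℝ := fun i => if i ∈ S then 1 else 0

/-- A design measure on the nonzero binary vectors of length `q`, indexed by
their supports: nonnegative masses summing to 1, with zero mass on the zero vector. -/
def designMeasureB {q : ℕ} (p : Finset (Fin q) → ℝ) : Prop :=
  p ∅ = 0 ∧ (∀ S, 0 ≤ p S) ∧ ∑ S : Finset (Fin q), p S = 1

/-- G(p) = Σ p_x x xᵀ. -/
def GmatB {q : ℕ} (p : Finset (Fin q) → ℝ) : Matrix (Fin q) (Fin q) ℝ :=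
  ∑ S : Finset (Fin q), p S • Matrix.vecMulVec (ind S) (ind S)

/-- g(p) = Σ p_x x. -/
def gvecB {q : ℕ} (p : Finset (Fin q) → ℝ) : Fin q → ℝ :=
  ∑ S : Finset (Fin q), p S • ind S

/-- H(p) = G(p) − t g(p) g(p)ᵀ. -/
def HmatB {q : ℕ} (t : ℝ) (p : Finset (Fin q) → ℝ) : Matrix (Fin q) (Fin q) ℝ :=
  GmatB p - t • Matrix.vecMulVec (gvecB p) (gvecB p)

/-- The all-ones q×q matrix J_q. -/
def Jmat (q : ℕ) : Matrix (Fin q) (Fin q) ℝ := Matrix.of fun _ _ => 1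

end

noncomputable def KK (q : ℕ) (x y : ℝ) : Matrix (Fin q) (Fin q) ℝ := x • 1 + ((y - x) / q) • Jmat q

lemma JJ (q : ℕ) : Jmat q * Jmat q = (q : ℝ) • Jmat q := by
  ext i k
  simp [Jmat, Matrix.mul_apply]

lemma KK_mul (q : ℕ) (hq : 0 < q) (x y x' y' : ℝ) :
    KK q x y * KK q x' y' = KK q (x * x') (y * y') := by
  have hq' : (q : ℝ) ≠ 0 := by positivity
  unfold KK
  rw [add_mul, mul_add, mul_add]
  simp only [Matrix.smul_mul, Matrix.mul_smul, JJ, one_mul, mul_one, smul_smul]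
  rw [add_assoc, ← add_smul, ← add_smul]
  congr 2
  · ring
  · field_simp
    ring

lemma KK_one (q : ℕ) : KK q 1 1 = 1 := by simp [KK]

lemma KK_trace (q : ℕ) (hq : 0 < q) (x y : ℝ) : (KK q x y).trace = (q - 1) * x + y := by
  have hq' : (q : ℝ) ≠ 0 := by positivity
  have : (Jmat q).trace = q := by simp [Jmat, Matrix.trace]
  simp only [KK, Matrix.trace_add, Matrix.trace_smul, this, Matrix.trace_one, Fintype.card_fin,
    smul_eq_mul]
  field_simp
  ring

lemma KK_inv (q : ℕ) (hq : 0 < q) (x y : ℝ) (hx : x ≠ 0) (hy : y ≠ 0) :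
    IsUnit (KK q x y).det ∧ (KK q x y)⁻¹ = KK q x⁻¹ y⁻¹ := by
  have h : KK q x y * KK q x⁻¹ y⁻¹ = 1 := by
    rw [KK_mul q hq, mul_inv_cancel₀ hx, mul_inv_cancel₀ hy, KK_one]
  exact ⟨Matrix.isUnit_det_of_right_inverse h, Matrix.inv_eq_right_inv h⟩

lemma KK_transpose (q : ℕ) (x y : ℝ) : (KK q x y)ᵀ = KK q x y := by
  have : (Jmat q)ᵀ = Jmat q := by ext; simp [Jmat]
  simp [KK, this]

lemma KK_mul_trace (q : ℕ) (x y : ℝ) (H : Matrix (Fin q) (Fin q) ℝ) :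
    (KK q x y * H).trace = x * H.trace + (y - x) / q * ∑ i, ∑ k, H i k := by
  have : (Jmat q * H).trace = ∑ i, ∑ k, H i k := by
    simp only [Matrix.trace, Matrix.diag_apply, Matrix.mul_apply, Jmat, Matrix.of_apply, one_mul]
    exact Finset.sum_comm
  simp only [KK, add_mul, Matrix.smul_mul, one_mul, Matrix.trace_add, Matrix.trace_smul, this,
    smul_eq_mul]

lemma G_apply {q : ℕ} (p : Finset (Fin q) → ℝ) (i k : Fin q) :
    GmatB p i k = ∑ S, p S * (ind S i * ind S k) := by
  simp [GmatB, Matrix.sum_apply, Matrix.vecMulVec_apply]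

lemma g_apply {q : ℕ} (p : Finset (Fin q) → ℝ) (i : Fin q) :
    gvecB p i = ∑ S, p S * ind S i := by
  simp [gvecB, Finset.sum_apply]

lemma ind_sum {q : ℕ} (S : Finset (Fin q)) : ∑ i, ind S i = S.card := by
  simp [ind]

lemma ind_sq {q : ℕ} (S : Finset (Fin q)) (i : Fin q) : ind S i * ind S i = ind S i := by
  simp [ind]

lemma G_diag {q : ℕ} (p : Finset (Fin q) → ℝ) (i : Fin q) : GmatB p i i = gvecB p i := by
  simp [G_apply, g_apply, ind_sq]

lemma g_sum {q : ℕ} (p : Finset (Fin q) → ℝ) :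
    ∑ i, gvecB p i = ∑ S, p S * (S.card : ℝ) := by
  simp only [g_apply]
  rw [Finset.sum_comm]
  simp only [← Finset.mul_sum, ind_sum]

lemma G_sum {q : ℕ} (p : Finset (Fin q) → ℝ) :
    ∑ i, ∑ k, GmatB p i k = ∑ S, p S * (S.card : ℝ) ^ 2 := by
  have h : ∀ i, ∑ k, GmatB p i k = ∑ S, p S * (ind S i * S.card) := by
    intro i
    simp only [G_apply]
    rw [Finset.sum_comm]
    simp only [← Finset.mul_sum, ind_sum]
  simp only [h]
  rw [Finset.sum_comm]
  simp only [← Finset.mul_sum, ← Finset.sum_mul, ind_sum, sq]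

lemma H_trace {q : ℕ} (t : ℝ) (p : Finset (Fin q) → ℝ) :
    (HmatB t p).trace = (∑ S, p S * (S.card : ℝ)) - t * ∑ i, gvecB p i ^ 2 := by
  rw [← g_sum]
  simp [HmatB, Matrix.trace, Matrix.vecMulVec_apply, G_diag, Finset.mul_sum, sq]

lemma H_sum {q : ℕ} (t : ℝ) (p : Finset (Fin q) → ℝ) :
    ∑ i, ∑ k, HmatB t p i k =
      (∑ S, p S * (S.card : ℝ) ^ 2) - t * (∑ S, p S * (S.card : ℝ)) ^ 2 := by
  rw [← g_sum, ← G_sum, sq, Finset.sum_mul_sum]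
  simp [HmatB, Matrix.vecMulVec_apply, Finset.mul_sum]

lemma H_psd {q : ℕ} (t : ℝ) (ht0 : 0 ≤ t) (ht1 : t < 1) (p : Finset (Fin q) → ℝ)
    (hp : designMeasureB p) : (HmatB t p).PosSemidef := by
  obtain ⟨-, hnn, hsum⟩ := hp
  refine Matrix.PosSemidef.of_dotProduct_mulVec_nonneg ?_ ?_
  · ext i k
    simp only [HmatB, Matrix.conjTranspose_apply, Matrix.sub_apply, Matrix.smul_apply,
      Matrix.vecMulVec_apply, G_apply, star_trivial, smul_eq_mul]
    congr 1
    · exact Finset.sum_congr rfl fun S _ => by ring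
    · ring
  · intro v
    have e1 : star v ⬝ᵥ (HmatB t p *ᵥ v) =
        (∑ S, p S * (ind S ⬝ᵥ v) ^ 2) - t * (∑ S, p S * (ind S ⬝ᵥ v)) ^ 2 := by
      simp only [HmatB, GmatB, gvecB, star_trivial, Matrix.sub_mulVec, Matrix.smul_mulVec,
        Matrix.sum_mulVec, Matrix.vecMulVec_mulVec, dotProduct_sub, dotProduct_smul,
        dotProduct_sum, sum_dotProduct, smul_dotProduct, smul_eq_mul,
        op_smul_eq_smul]
      congr 1
      · refine Finset.sum_congr rfl fun S _ => ?_
        rw [dotProduct_comm v]; ring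
      · simp only [dotProduct_comm v]; ring
    rw [e1]
    have hcs : (∑ S, p S * (ind S ⬝ᵥ v)) ^ 2 ≤ ∑ S, p S * (ind S ⬝ᵥ v) ^ 2 := by
      have h := Finset.sum_nonneg (s := Finset.univ) (f := fun S => p S *
        ((ind S ⬝ᵥ v) - ∑ S, p S * (ind S ⬝ᵥ v)) ^ 2) (fun S _ => mul_nonneg (hnn S) (sq_nonneg _))
      obtain ⟨M, hM⟩ : ∃ M, M = ∑ S, p S * (ind S ⬝ᵥ v) := ⟨_, rfl⟩
      rw [← hM] at h ⊢
      have e : ∑ S, p S * ((ind S ⬝ᵥ v) - M) ^ 2 =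
          (∑ S, p S * (ind S ⬝ᵥ v) ^ 2) - 2 * M * (∑ S, p S * (ind S ⬝ᵥ v)) + M ^ 2 * ∑ S, p S := by
        rw [Finset.mul_sum, Finset.mul_sum, ← Finset.sum_sub_distrib, ← Finset.sum_add_distrib]
        exact Finset.sum_congr rfl fun S _ => by ring
      rw [e, hsum, ← hM] at h
      nlinarith
    nlinarith [sq_nonneg (∑ S, p S * (ind S ⬝ᵥ v))]

lemma trace_ineq {q : ℕ} (H K : Matrix (Fin q) (Fin q) ℝ) (hH : H.PosSemidef)
    (hdet : IsUnit H.det) (hK : Kᵀ = K) :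
    2 * K.trace - (K * K * H).trace ≤ H⁻¹.trace := by
  have hHi : (H⁻¹)ᴴ = H⁻¹ := hH.isHermitian.inv
  have hKi : Kᴴ = K := by rw [Matrix.conjTranspose_eq_transpose_of_trivial, hK]
  have h := (hH.mul_mul_conjTranspose_same (H⁻¹ - K)).trace_nonneg
  have e : (H⁻¹ - K) * H * (H⁻¹ - K)ᴴ = H⁻¹ - K - K + K * H * K := by
    rw [Matrix.conjTranspose_sub, hHi, hKi, sub_mul, Matrix.nonsing_inv_mul _ hdet, sub_mul,
      mul_sub (K * H), one_mul, mul_assoc K H H⁻¹, Matrix.mul_nonsing_inv _ hdet, mul_one]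
    abel
  rw [e, Matrix.trace_add, Matrix.trace_sub, Matrix.trace_sub, Matrix.trace_mul_comm (K * H) K,
    ← mul_assoc] at h
  linarith

lemma suff (m : ℕ) (hm : 2 ≤ m) (t : ℝ) (ht0 : 0 ≤ t) (ht1 : t < 1)
    (hc : 1 + 2 * m * (1 - t) ≤ (2 * m - 1 : ℝ) ^ 2 * (1 - t) ^ 2)
    (p : Finset (Fin (2*m)) → ℝ) (hp : designMeasureB p) (hdet : IsUnit (HmatB t p).det) :
    2 * m * (2 * m - 1 : ℝ) ^ 2 / (m ^ 2 - 0) +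
      2 * m / (m ^ 2 * (1 - t) + 0 * (2 * m * (1 - t) + 1) - t * 0 ^ 2)
      ≤ (HmatB t p)⁻¹.trace := by
  have hmR : (2:ℝ) ≤ m := by exact_mod_cast hm
  have hm0 : (0:ℝ) < m := by linarith
  obtain ⟨u, hu⟩ : ∃ u, u = 1 - t := ⟨_, rfl⟩
  have hu0 : 0 < u := by linarith
  have hr : (0:ℝ) < 2 * m - 1 := by linarith
  set a : ℝ := 2 * m * (2 * m - 1) / m ^ 2 with ha
  set l : ℝ := 2 * m / (m ^ 2 * u) with hl
  have key := trace_ineq (HmatB t p) (KK (2*m) a l) (H_psd t ht0 ht1 p hp) hdet (KK_transpose _ _ _)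
  rw [KK_mul _ (by omega), KK_mul_trace, KK_trace _ (by omega), H_trace, H_sum] at key
  have hcs : (∑ i, gvecB p i) ^ 2 ≤ (2 * m : ℝ) * ∑ i, gvecB p i ^ 2 := by
    have := sq_sum_le_card_mul_sum_sq (s := Finset.univ) (f := gvecB p)
    simpa using this
  rw [g_sum] at hcs
  obtain ⟨-, hnn, hsum⟩ := hp
  set M1 := ∑ S, p S * (S.card : ℝ) with hM1
  set M2 := ∑ S, p S * (S.card : ℝ) ^ 2 with hM2
  set Q := ∑ i, gvecB p i ^ 2
  have eV : ∑ S, p S * ((S.card : ℝ) - m) ^ 2 = M2 - 2 * m * M1 + m ^ 2 := by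
    have : (m:ℝ) ^ 2 = m ^ 2 * ∑ S, p S := by rw [hsum, mul_one]
    rw [this, hM1, hM2, Finset.mul_sum, Finset.mul_sum, ← Finset.sum_sub_distrib,
      ← Finset.sum_add_distrib]
    exact Finset.sum_congr rfl fun S _ => by ring
  have emu : ∑ S, p S * ((S.card : ℝ) - m) = M1 - m := by
    have : (m:ℝ) = m * ∑ S, p S := by rw [hsum, mul_one]
    rw [hM1]
    nth_rewrite 2 [this]
    rw [Finset.mul_sum, ← Finset.sum_sub_distrib]
    exact Finset.sum_congr rfl fun S _ => by ring
  have hV0 : 0 ≤ M2 - 2 * m * M1 + m ^ 2 := by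
    rw [← eV]; exact Finset.sum_nonneg fun S _ => mul_nonneg (hnn S) (sq_nonneg _)
  have hV1 : M1 - m ≤ M2 - 2 * m * M1 + m ^ 2 := by
    rw [← eV, ← emu]
    refine Finset.sum_le_sum fun S _ => mul_le_mul_of_nonneg_left ?_ (hnn S)
    have : ((S.card : ℤ) - m) ≤ ((S.card : ℤ) - m) ^ 2 := Int.le_self_sq _
    exact_mod_cast this
  obtain ⟨V, hV⟩ : ∃ V, V = M2 - 2 * m * M1 + m ^ 2 := ⟨_, rfl⟩
  obtain ⟨μ, hμ⟩ : ∃ μ, μ = M1 - m := ⟨_, rfl⟩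
  rw [← hV] at hV0 hV1
  rw [← hμ] at hV1
  have hM1' : M1 = m + μ := by linarith
  have hM2' : M2 = m ^ 2 + 2 * m * μ + V := by rw [hV, hM1']; ring
  have ht : t = 1 - u := by linarith
  have hxy : 2 * m * u * (l * l) ≤ a * a - l * l := by
    have e1 : l * l * u ^ 2 * (2 * m - 1) ^ 2 = a * a := by
      rw [ha, hl]; field_simp
    have : l * l * (1 + 2 * m * u) ≤ l * l * ((2 * m - 1 : ℝ) ^ 2 * u ^ 2) :=
      mul_le_mul_of_nonneg_left (by rw [hu]; exact hc) (mul_self_nonneg l)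
    nlinarith
  have ex : a * a * m ^ 2 = 2 * m * (2 * m - 1) * a := by
    rw [ha]; field_simp
  have ey : l * l * (u * m ^ 2) = 2 * m * l := by
    rw [hl]; field_simp
  have goal1 : 2 * m * (2 * m - 1 : ℝ) ^ 2 / (m ^ 2 - 0) +
      2 * m / (m ^ 2 * (1 - t) + 0 * (2 * m * (1 - t) + 1) - t * 0 ^ 2) = (2 * m - 1) * a + l := by
    rw [ha, hl, hu]
    congr 1
    · rw [sub_zero]; ring
    · congr 1; ring
  rw [goal1]
  push_cast at key
  refine le_trans ?_ key
  have hmain : a * a * (M1 - t * Q) + (l * l - a * a) / (2 * m) * (M2 - t * M1 ^ 2)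
      ≤ (2 * m - 1) * a + l := by
    have e2 : a * a * (M1 - t * Q) + (l * l - a * a) / (2 * m) * (M2 - t * M1 ^ 2)
      = (a * a * (2 * m * M1 - M2) + l * l * (M2 - t * M1 ^ 2)
          - t * (a * a) * (2 * m * Q - M1 ^ 2)) / (2 * m) := by
      field_simp
      ring
    rw [e2, div_le_iff₀ (by positivity)]
    have h3 : 0 ≤ t * (a * a) * (2 * m * Q - M1 ^ 2) :=
      mul_nonneg (mul_nonneg ht0 (mul_self_nonneg a)) (by linarith)
    have h4 : 2 * m * u * (l * l) * V ≤ (a * a - l * l) * V :=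
      mul_le_mul_of_nonneg_right hxy hV0
    have h5 : 2 * m * u * (l * l) * μ ≤ 2 * m * u * (l * l) * V :=
      mul_le_mul_of_nonneg_left hV1 (by have := mul_self_nonneg l; positivity)
    have h6 : 0 ≤ l * l * (t * μ ^ 2) := by have := mul_self_nonneg l; positivity
    have e3 : a * a * (2 * m * M1 - M2) + l * l * (M2 - t * M1 ^ 2) =
        a * a * m ^ 2 + l * l * (u * m ^ 2) + 2 * m * u * (l * l) * μ - (a * a - l * l) * V
          - l * l * (t * μ ^ 2) := by
      rw [hM1', hM2', ht]; ring
    rw [e3, ex, ey]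
    linarith
  linarith

/-- exchangeable designs -/
lemma exch {q : ℕ} (hq : 2 ≤ q) (t : ℝ) (f : ℕ → ℝ) (M1 M2 : ℝ)
    (h1 : ∑ S : Finset (Fin q), f S.card * (S.card : ℝ) = M1)
    (h2 : ∑ S : Finset (Fin q), f S.card * (S.card : ℝ) ^ 2 = M2) :
    HmatB t (fun S : Finset (Fin q) => f S.card) =
      KK q ((q * M1 - M2) / (q * (q - 1))) ((M2 - t * M1 ^ 2) / q) := by
  set p : Finset (Fin q) → ℝ := fun S => f S.card with hp
  have hqR : (2:ℝ) ≤ q := by exact_mod_cast hq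
  have hsym : ∀ (σ : Equiv.Perm (Fin q)) i k, GmatB p (σ i) (σ k) = GmatB p i k := by
    intro σ i k
    rw [G_apply, G_apply]
    refine (Fintype.sum_equiv (Equiv.finsetCongr σ) _ _ fun S => ?_).symm
    simp [hp, ind, Equiv.finsetCongr_apply]
  let i0 : Fin q := ⟨0, by omega⟩
  let i1 : Fin q := ⟨1, by omega⟩
  have h01 : i0 ≠ i1 := by simp [i0, i1]
  have hd : ∀ i, GmatB p i i = GmatB p i0 i0 := by
    intro i
    have := hsym (Equiv.swap i0 i) i0 i0
    simpa using this
  have ho : ∀ i k, i ≠ k → GmatB p i k = GmatB p i0 i1 := by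
    intro i k hik
    obtain ⟨σ, hσ0, hσ1⟩ : ∃ σ : Equiv.Perm (Fin q), σ i0 = i ∧ σ i1 = k := by
      refine ⟨Equiv.swap (Equiv.swap i0 i i1) k * Equiv.swap i0 i, ?_, ?_⟩
      · simp only [Equiv.Perm.mul_apply, Equiv.swap_apply_left]
        refine Equiv.swap_apply_of_ne_of_ne ?_ hik
        intro h
        have h' : Equiv.swap i0 i i0 = Equiv.swap i0 i i1 := by
          rw [Equiv.swap_apply_left]; exact h
        exact h01 ((Equiv.swap i0 i).injective h')
      · simp [Equiv.Perm.mul_apply]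
    rw [← hσ0, ← hσ1, hsym]
  set d := GmatB p i0 i0
  set c := GmatB p i0 i1
  have hg : ∀ i, gvecB p i = d := fun i => by rw [← G_diag, hd]
  have hGe : ∀ i k, GmatB p i k = c + (if i = k then d - c else 0) := by
    intro i k
    by_cases h : i = k
    · subst h; simp [hd]
    · simp [h, ho i k h]
  have s1 : (q:ℝ) * d = M1 := by
    rw [← h1, ← g_sum p]; simp [hg]
  have s2 : (q:ℝ) * (q * c + (d - c)) = M2 := by
    rw [← h2, ← G_sum p]; simp [hGe, Finset.sum_add_distrib]; ring
  have hq0 : (q:ℝ) ≠ 0 := by linarith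
  have hq1 : (q:ℝ) - 1 ≠ 0 := by linarith
  have e1 : (q * M1 - M2) / (q * (q - 1)) = d - c := by
    rw [← s2, ← s1]; field_simp; ring
  have e2 : ((M2 - t * M1 ^ 2) / q - (d - c)) / q = c - t * d ^ 2 := by
    rw [← s2, ← s1]; field_simp; ring
  ext i k
  rw [KK, e1, e2]
  simp only [HmatB, Matrix.sub_apply, Matrix.smul_apply, Matrix.vecMulVec_apply, hg, hGe,
    Matrix.add_apply, Jmat, Matrix.of_apply, Matrix.one_apply, smul_eq_mul]
  split_ifs <;> ring

noncomputable def pw (m : ℕ) (e : ℝ) (j : ℕ) : ℝ :=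
  (1 - e) * (if j = m then ((Nat.choose (2*m) m : ℝ))⁻¹ else 0) +
    e * (if j = m + 1 then ((Nat.choose (2*m) (m+1) : ℝ))⁻¹ else 0)

lemma layer (q k : ℕ) (hk : k ≤ q) (h : ℕ → ℝ) :
    ∑ S : Finset (Fin q), (if S.card = k then ((Nat.choose q k : ℝ))⁻¹ else 0) * h S.card = h k := by
  have hc : (Nat.choose q k : ℝ) ≠ 0 := by exact_mod_cast (Nat.choose_pos hk).ne'
  have e : ∀ S : Finset (Fin q), (if S.card = k then ((Nat.choose q k : ℝ))⁻¹ else 0) * h S.card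
      = if S.card = k then ((Nat.choose q k : ℝ))⁻¹ * h k else 0 := by
    intro S
    split_ifs with hS
    · rw [hS]
    · simp
  simp only [e]
  rw [← Finset.sum_filter, Finset.sum_const, Finset.univ_filter_card_eq, Finset.card_powersetCard]
  simp only [Finset.card_univ, Fintype.card_fin, nsmul_eq_mul]
  field_simp

lemma pw_sum (m : ℕ) (hm : 2 ≤ m) (e : ℝ) (h : ℕ → ℝ) :
    ∑ S : Finset (Fin (2*m)), pw m e S.card * h S.card = (1 - e) * h m + e * h (m + 1) := by
  rw [← layer (2*m) m (by omega) h, ← layer (2*m) (m+1) (by omega) h, Finset.mul_sum,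
    Finset.mul_sum, ← Finset.sum_add_distrib]
  exact Finset.sum_congr rfl fun S _ => by unfold pw; ring

lemma pw_H (m : ℕ) (hm : 2 ≤ m) (t : ℝ) (ht0 : 0 ≤ t) (ht1 : t < 1) (e : ℝ) (he0 : 0 ≤ e)
    (he1 : e < 1) :
    designMeasureB (fun S : Finset (Fin (2*m)) => pw m e S.card) ∧
    IsUnit (HmatB t (fun S : Finset (Fin (2*m)) => pw m e S.card)).det ∧
    ((HmatB t (fun S : Finset (Fin (2*m)) => pw m e S.card))⁻¹).trace =
      2 * m * (2 * m - 1 : ℝ) ^ 2 / (m ^ 2 - e) +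
      2 * m / (m ^ 2 * (1 - t) + e * (2 * m * (1 - t) + 1) - t * e ^ 2) := by
  have hmR : (2:ℝ) ≤ m := by exact_mod_cast hm
  have hu : 0 < 1 - t := by linarith
  have hA : 0 < (m:ℝ) ^ 2 - e := by nlinarith
  have hL : 0 < (m:ℝ) ^ 2 * (1 - t) + e * (2 * m * (1 - t) + 1) - t * e ^ 2 := by
    have h1 : 0 < (m:ℝ) ^ 2 * (1 - t) := by positivity
    have h2 : 0 ≤ e * (2 * m * (1 - t)) := by positivity
    have h3 : t * e ^ 2 ≤ 1 * e := mul_le_mul ht1.le (by nlinarith) (by positivity) (by norm_num)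
    nlinarith
  have hr : (0:ℝ) < 2 * m - 1 := by linarith
  refine ⟨⟨?_, ?_, ?_⟩, ?_⟩
  · have : 0 ≠ m := by omega
    simp [pw, this]
  · intro S
    have : 0 ≤ 1 - e := by linarith
    unfold pw
    positivity
  · have := pw_sum m hm e (fun _ => 1)
    simpa using this
  · have hH := exch (q := 2*m) (by omega) t (pw m e) (m + e) (m ^ 2 + e * (2 * m + 1))
      (by rw [pw_sum m hm e (fun j => (j:ℝ))]; push_cast; ring)
      (by rw [pw_sum m hm e (fun j => (j:ℝ) ^ 2)]; push_cast; ring)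
    have e1 : (((2*m : ℕ) : ℝ) * (m + e) - (m ^ 2 + e * (2 * m + 1))) /
        (((2*m : ℕ) : ℝ) * (((2*m : ℕ) : ℝ) - 1)) = (m ^ 2 - e) / (2 * m * (2 * m - 1)) := by
      push_cast; congr 1; ring
    have e2 : ((m:ℝ) ^ 2 + e * (2 * m + 1) - t * (m + e) ^ 2) / ((2*m : ℕ) : ℝ) =
        (m ^ 2 * (1 - t) + e * (2 * m * (1 - t) + 1) - t * e ^ 2) / (2 * m) := by
      push_cast; congr 1; ring
    rw [e1, e2] at hH
    obtain ⟨hd, hi⟩ := KK_inv (2*m) (by omega) ((m ^ 2 - e) / (2 * m * (2 * m - 1)))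
      ((m ^ 2 * (1 - t) + e * (2 * m * (1 - t) + 1) - t * e ^ 2) / (2 * m))
      (by positivity) (by positivity)
    rw [hH]
    refine ⟨hd, ?_⟩
    rw [hi, KK_trace _ (by omega), inv_div, inv_div]
    push_cast
    ring

lemma exists_eps (m : ℕ) (hm : 2 ≤ m) (t : ℝ) (ht0 : 0 ≤ t) (ht1 : t < 1)
    (hc : (2 * m - 1 : ℝ) ^ 2 * (1 - t) ^ 2 < 1 + 2 * m * (1 - t)) :
    ∃ e : ℝ, 0 < e ∧ e < 1 ∧
      2 * m * (2 * m - 1 : ℝ) ^ 2 / (m ^ 2 - e) +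
        2 * m / (m ^ 2 * (1 - t) + e * (2 * m * (1 - t) + 1) - t * e ^ 2) <
      2 * m * (2 * m - 1 : ℝ) ^ 2 / (m ^ 2 - 0) +
        2 * m / (m ^ 2 * (1 - t) + 0 * (2 * m * (1 - t) + 1) - t * 0 ^ 2) := by
  have hmR : (2:ℝ) ≤ m := by exact_mod_cast hm
  have hu : 0 < 1 - t := by linarith
  have hm0 : (0:ℝ) < m := by linarith
  have hev : ∀ᶠ e in nhds (0:ℝ),
      (2 * m - 1 : ℝ) ^ 2 * (m ^ 2 * (1 - t) + e * (2 * m * (1 - t) + 1) - t * e ^ 2) * (1 - t) <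
        (2 * m * (1 - t) + 1 - t * e) * (m ^ 2 - e) := by
    refine ContinuousAt.eventually_lt (by fun_prop) (by fun_prop) ?_
    have : (m:ℝ) ^ 2 * ((2 * m - 1 : ℝ) ^ 2 * (1 - t) ^ 2) < m ^ 2 * (1 + 2 * m * (1 - t)) :=
      mul_lt_mul_of_pos_left hc (by positivity)
    nlinarith
  have hev1 : ∀ᶠ e in nhds (0:ℝ), e < 1 := eventually_lt_nhds one_pos
  have hpos : ∀ᶠ e in nhdsWithin (0:ℝ) (Set.Ioi 0), 0 < e := eventually_mem_nhdsWithin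
  obtain ⟨e, ⟨he, he1⟩, he0⟩ := (((hev.and hev1).filter_mono nhdsWithin_le_nhds).and hpos).exists
  refine ⟨e, he0, he1, ?_⟩
  have hA : 0 < (m:ℝ) ^ 2 - e := by nlinarith
  have hL : 0 < (m:ℝ) ^ 2 * (1 - t) + e * (2 * m * (1 - t) + 1) - t * e ^ 2 := by
    have h1 : 0 < (m:ℝ) ^ 2 * (1 - t) := by positivity
    have h2 : 0 ≤ e * (2 * m * (1 - t)) := by positivity
    have h3 : t * e ^ 2 ≤ 1 * e := mul_le_mul ht1.le (by nlinarith) (by positivity) (by norm_num)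
    nlinarith
  rw [← sub_pos]
  have hz : (m:ℝ) ^ 2 * (1 - t) + 0 * (2 * m * (1 - t) + 1) - t * 0 ^ 2 = m ^ 2 * (1 - t) := by ring
  rw [hz, sub_zero]
  set L := (m:ℝ) ^ 2 * (1 - t) + e * (2 * m * (1 - t) + 1) - t * e ^ 2 with hLd
  obtain ⟨u, huu⟩ : ∃ u, u = 1 - t := ⟨_, rfl⟩
  rw [← huu] at he hu hLd ⊢
  have e1 : 2 * m * (2 * m - 1 : ℝ) ^ 2 / m ^ 2 + 2 * m / (m ^ 2 * u) -
      (2 * m * (2 * m - 1 : ℝ) ^ 2 / (m ^ 2 - e) + 2 * m / L) =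
      2 * m * e * ((2 * m * u + 1 - t * e) * (m ^ 2 - e) - (2 * m - 1 : ℝ) ^ 2 * L * u) /
        (m ^ 2 * u * (m ^ 2 - e) * L) := by
    have hA' := hA.ne'
    have hL' := hL.ne'
    have : (2 * m * u + 1 - t * e) * e = L - m ^ 2 * u := by rw [hLd]; ring
    field_simp
    linear_combination (-(m ^ 2 - e)) * this
  rw [e1]
  have := sub_pos.2 he
  positivity

lemma thresh (m : ℕ) (hm : 2 ≤ m) (t : ℝ) (ht1 : t < 1) :
    (t ≤ 1 - (1/2) * ((2*m : ℝ) - 1)⁻¹^2 *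
        ((2*m : ℝ) + Real.sqrt (4 * ((2*m : ℝ) - 1)^2 + (2*m : ℝ)^2))) ↔
      1 + 2 * m * (1 - t) ≤ (2 * m - 1 : ℝ) ^ 2 * (1 - t) ^ 2 := by
  have hmR : (2:ℝ) ≤ m := by exact_mod_cast hm
  obtain ⟨q, hq⟩ : ∃ q : ℝ, q = 2 * m := ⟨_, rfl⟩
  obtain ⟨u, hu⟩ : ∃ u, u = 1 - t := ⟨_, rfl⟩
  have hu0 : 0 < u := by linarith
  rw [← hq, ← hu]
  obtain ⟨r, hr⟩ : ∃ r, r = q - 1 := ⟨_, rfl⟩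
  rw [← hr]
  have hr0 : 0 < r := by linarith
  have hq0 : 0 < q := by linarith
  have h1 : (t ≤ 1 - (1/2) * r⁻¹^2 * (q + Real.sqrt (4 * r^2 + q^2))) ↔
      Real.sqrt (4 * r^2 + q^2) ≤ 2 * r ^ 2 * u - q := by
    have e : (1/2) * r⁻¹^2 * (q + Real.sqrt (4 * r^2 + q^2)) =
      (q + Real.sqrt (4 * r^2 + q^2)) / (2 * r ^ 2) := by field_simp
    rw [e, le_sub_comm, ← hu, div_le_iff₀ (by positivity)]
    constructor <;> intro h <;> linarith
  rw [h1, Real.sqrt_le_iff]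
  constructor
  · rintro ⟨-, h⟩
    have : r ^ 2 * (1 + q * u) ≤ r ^ 2 * (r ^ 2 * u ^ 2) := by nlinarith
    exact le_of_mul_le_mul_left this (by positivity)
  · intro h
    constructor
    · have : u * q ≤ u * (r ^ 2 * u) := by nlinarith
      have := le_of_mul_le_mul_left this hu0
      nlinarith
    · have : r ^ 2 * (1 + q * u) ≤ r ^ 2 * (r ^ 2 * u ^ 2) := mul_le_mul_of_nonneg_left h (by positivity)
      nlinarith

theorem statement_13 (m : ℕ) (hm : 2 ≤ m) (t : ℝ) (ht0 : 0 ≤ t) (ht1 : t < 1) :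
    (IsUnit (HmatB t (fun S : Finset (Fin (2*m)) =>
          if S.card = m then ((Nat.choose (2*m) m : ℝ))⁻¹ else 0)).det
      ∧ ∀ p : Finset (Fin (2*m)) → ℝ, designMeasureB p → IsUnit (HmatB t p).det →
          Matrix.trace ((HmatB t (fun S : Finset (Fin (2*m)) =>
              if S.card = m then ((Nat.choose (2*m) m : ℝ))⁻¹ else 0))⁻¹)
            ≤ Matrix.trace ((HmatB t p)⁻¹))
    ↔ (0 ≤ t ∧ t ≤ 1 - (1/2) * ((2*m : ℝ) - 1)⁻¹^2 *
        ((2*m : ℝ) + Real.sqrt (4 * ((2*m : ℝ) - 1)^2 + (2*m : ℝ)^2))) := by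
  have hp0 : (fun S : Finset (Fin (2*m)) =>
      if S.card = m then ((Nat.choose (2*m) m : ℝ))⁻¹ else 0) = fun S => pw m 0 S.card := by
    funext S; simp [pw]
  rw [hp0, thresh m hm t ht1]
  have hu : 0 < 1 - t := by linarith
  have hmR : (2:ℝ) ≤ m := by exact_mod_cast hm
  obtain ⟨h00, h01, h02⟩ := pw_H m hm t ht0 ht1 0 le_rfl zero_lt_one
  constructor
  · rintro ⟨-, hopt⟩
    by_contra hcon
    simp only [ht0, true_and, not_le] at hcon
    obtain ⟨e, he0, he1, hlt⟩ := exists_eps m hm t ht0 ht1 hcon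
    obtain ⟨h10, h11, h12⟩ := pw_H m hm t ht0 ht1 e he0.le he1
    have := hopt _ h10 h11
    rw [h12, h02] at this
    linarith
  · rintro ⟨-, hc⟩
    refine ⟨h01, fun p hp hdet => ?_⟩
    rw [h02]
    exact suff m hm t ht0 ht1 hc p hp hdet
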